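/- Triviality for linear TGDs is decidable: the set of (encodings of) tuples (T, ΣD, ΣQ), where T is a finite set of linear TGDs and ΣD, ΣQ are finite schemas, such that T is ΣD,ΣQ-trivial, is computable. -/

import Mathlib

set_option autoImplicit false

/-! ### Terms: constants from 𝐂 (coded `Term.const n`) and nulls from 𝐍 (coded `Term.null n`) -/

inductive Term : Type
  | const : ℕ → Term
  | null  : ℕ → Term
deriving DecidableEq

def Term.isConst : Term → Prop
  | .const _ => True
  | .null _  => False

def termEquiv : Term ≃ ℕ ⊕ ℕ where
  toFun t := match t with
    | .const n => Sum.inl n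
    | .null n  => Sum.inr n
  invFun x := match x with
    | Sum.inl n => .const n
    | Sum.inr n => .null n
  left_inv t := by cases t <;> rfl
  right_inv x := by cases x <;> rfl

instance : Primcodable Term := Primcodable.ofEquiv _ termEquiv

/-! ### Relation symbols (with arity) and schemas -/

structure RelSym : Type where
  name : ℕ
  arity : ℕ
deriving DecidableEq

def relSymEquiv : RelSym ≃ ℕ × ℕ where
  toFun r := (r.name, r.arity)
  invFun p := ⟨p.1, p.2⟩
  left_inv r := rfl
  right_inv p := rfl

instance : Primcodable RelSym := Primcodable.ofEquiv _ relSymEquiv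

/-- A schema is a set of relation symbols. -/
abbrev Schema := Set RelSym

/-! ### Facts, instances, databases -/

structure Fct : Type where
  rel : RelSym
  args : List Term
deriving DecidableEq

def fctEquiv : Fct ≃ RelSym × List Term where
  toFun f := (f.rel, f.args)
  invFun p := ⟨p.1, p.2⟩
  left_inv f := rfl
  right_inv p := rfl

instance : Primcodable Fct := Primcodable.ofEquiv _ fctEquiv

/-- A fact is well-formed if its argument tuple matches the arity of its relation symbol
(arities are ≥ 1). -/
def Fct.wf (f : Fct) : Prop := f.args.length = f.rel.arity ∧ 1 ≤ f.rel.arity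

/-- An instance is a (possibly infinite) set of facts. -/
abbrev Inst := Set Fct

/-- The active domain of an instance. -/
def adom (I : Inst) : Set Term := { t | ∃ f ∈ I, t ∈ f.args }

/-- A database: a finite instance of well-formed facts using only constants from 𝐂. -/
def IsDB (I : Inst) : Prop :=
  I.Finite ∧ ∀ f ∈ I, f.wf ∧ ∀ t ∈ f.args, t.isConst

/-- `I` is a Σ-instance. -/
def InstOver (I : Inst) (S : Schema) : Prop := ∀ f ∈ I, f.rel ∈ S ∧ f.wf

/-- `I` is a Σ-database. -/
def IsDatabase (I : Inst) (S : Schema) : Prop := IsDB I ∧ ∀ f ∈ I, f.rel ∈ S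

/-! ### Homomorphisms -/

def Fct.map (h : Term → Term) (f : Fct) : Fct := ⟨f.rel, f.args.map h⟩

/-- `h` is a Σ-homomorphism from `I` to `J`. -/
def IsHomOn (S : Schema) (h : Term → Term) (I J : Inst) : Prop :=
  ∀ f ∈ I, f.rel ∈ S → f.map h ∈ J

/-- `h` is a homomorphism from `I` to `J` (all relation symbols). -/
def IsFullHom (h : Term → Term) (I J : Inst) : Prop := ∀ f ∈ I, f.map h ∈ J

/-- `h` is database-preserving: it is the identity on all constants from 𝐂. -/
def DBPres (h : Term → Term) : Prop := ∀ n : ℕ, h (Term.const n) = Term.const n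

/-- `I →_Σ J`: there is a database-preserving Σ-homomorphism from `I` to `J`. -/
def HomTo (S : Schema) (I J : Inst) : Prop := ∃ h, DBPres h ∧ IsHomOn S h I J

/-- The induced subinstance of `I` on a set `A` of terms. -/
def restrict (I : Inst) (A : Set Term) : Inst := { f | f ∈ I ∧ ∀ t ∈ f.args, t ∈ A }

/-- `I →ⁿ_Σ J`: every induced subinstance of `I` with at most `n` active-domain elements
admits a database-preserving Σ-homomorphism to `J`. -/
def HomN (S : Schema) (n : ℕ) (I J : Inst) : Prop :=
  ∀ A : Set Term, A ⊆ adom I → A.Finite → A.ncard ≤ n → HomTo S (restrict I A) J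

/-- `I →^lim_Σ J`. -/
def HomLim (S : Schema) (I J : Inst) : Prop := ∀ n : ℕ, 1 ≤ n → HomN S n I J

/-- Homomorphic equivalence of instances. -/
def HomEquiv (I J : Inst) : Prop := (∃ h, IsFullHom h I J) ∧ (∃ h, IsFullHom h J I)

/-! ### Gaifman graph and connectedness -/

def coOccur (I : Inst) (a b : Term) : Prop := ∃ f ∈ I, a ∈ f.args ∧ b ∈ f.args

/-- The Gaifman graph of `I` is connected. -/
def Connected (I : Inst) : Prop :=
  ∀ a ∈ adom I, ∀ b ∈ adom I, Relation.ReflTransGen (coOccur I) a b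

/-- Restriction `I|_Σ` of `I` to the facts using a relation symbol from Σ. -/
def restrS (I : Inst) (S : Schema) : Inst := { f | f ∈ I ∧ f.rel ∈ S }

/-- `I` is Σ-connected. -/
def SConnected (S : Schema) (I : Inst) : Prop := Connected (restrS I S)

/-- `C` is a maximally Σ-connected component of `I`. -/
def MaxConnComp (S : Schema) (I C : Inst) : Prop :=
  C ⊆ restrS I S ∧ Connected C ∧
    ∀ C', C ⊆ C' → C' ⊆ restrS I S → Connected C' → C' = C

/-! ### Conjunctive queries -/

structure Atom : Type where
  rel : RelSym
  args : List ℕ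
deriving DecidableEq

def atomEquiv : Atom ≃ RelSym × List ℕ where
  toFun a := (a.rel, a.args)
  invFun p := ⟨p.1, p.2⟩
  left_inv a := rfl
  right_inv p := rfl

instance : Primcodable Atom := Primcodable.ofEquiv _ atomEquiv

def Atom.wf (a : Atom) : Prop := a.args.length = a.rel.arity ∧ 1 ≤ a.rel.arity

/-- Instantiate an atom by an assignment of terms to variables. -/
def Atom.inst (h : ℕ → Term) (a : Atom) : Fct := ⟨a.rel, a.args.map h⟩

/-- A conjunctive query: a finite set of relational atoms (as a list) together with a
tuple of answer variables. -/
structure CQ : Type where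
  atoms : List Atom
  ans : List ℕ
deriving DecidableEq

def cqEquiv : CQ ≃ List Atom × List ℕ where
  toFun q := (q.atoms, q.ans)
  invFun p := ⟨p.1, p.2⟩
  left_inv q := rfl
  right_inv p := rfl

instance : Primcodable CQ := Primcodable.ofEquiv _ cqEquiv

/-- `q` is a CQ over schema Σ. -/
def CQ.Over (q : CQ) (S : Schema) : Prop := ∀ a ∈ q.atoms, a.rel ∈ S ∧ a.wf

/-- A homomorphism from `q` to `I`. -/
def CQHom (q : CQ) (I : Inst) (h : ℕ → Term) : Prop := ∀ a ∈ q.atoms, a.inst h ∈ I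

/-- `c̄` is an answer to `q` on `I`. -/
def IsAnswer (q : CQ) (I : Inst) (c : List Term) : Prop :=
  (∀ x ∈ c, x ∈ adom I) ∧ ∃ h, CQHom q I h ∧ q.ans.map h = c

/-- The canonical database of a CQ (variables viewed as constants/nulls). -/
def canonDB (q : CQ) : Inst := { f | ∃ a ∈ q.atoms, f = a.inst Term.null }

/-! ### Tuple-generating dependencies -/

/-- A TGD `∀x̄∀ȳ (φ(x̄,ȳ) → ∃z̄ ψ(x̄,z̄))`, with `frontier` the tuple `x̄` of
frontier variables. -/
structure TGD : Type where
  body : List Atom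
  head : List Atom
  frontier : List ℕ
deriving DecidableEq

def tgdEquiv : TGD ≃ List Atom × List Atom × List ℕ where
  toFun t := (t.body, t.head, t.frontier)
  invFun p := ⟨p.1, p.2.1, p.2.2⟩
  left_inv t := rfl
  right_inv p := rfl

instance : Primcodable TGD := Primcodable.ofEquiv _ tgdEquiv

def TGD.bodyVars (t : TGD) : Set ℕ := { x | ∃ a ∈ t.body, x ∈ a.args }
def TGD.headVars (t : TGD) : Set ℕ := { x | ∃ a ∈ t.head, x ∈ a.args }

/-- Well-formedness of a TGD: atoms are well-formed, the frontier variables are distinct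
body variables, and every variable shared by body and head is a frontier variable. -/
def TGD.wf (t : TGD) : Prop :=
  (∀ a ∈ t.body, a.wf) ∧ (∀ a ∈ t.head, a.wf) ∧ t.frontier.Nodup ∧
  (∀ x ∈ t.frontier, x ∈ t.bodyVars) ∧
  (∀ x, x ∈ t.bodyVars → x ∈ t.headVars → x ∈ t.frontier)

/-- A TGD is linear if its body contains at most one atom. -/
def TGD.Linear (t : TGD) : Prop := t.body.length ≤ 1

/-- A TGD is guarded if some body atom contains all body variables. -/
def TGD.Guarded (t : TGD) : Prop := ∃ a ∈ t.body, ∀ x, x ∈ t.bodyVars → x ∈ a.args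

/-- A TGD is frontier-one if it has exactly one frontier variable. -/
def TGD.FrontierOne (t : TGD) : Prop := t.frontier.length = 1

/-- `I ⊨ ϑ`. -/
def TGD.Satisfies (I : Inst) (t : TGD) : Prop :=
  ∀ g : ℕ → Term, (∀ a ∈ t.body, a.inst g ∈ I) →
    ∃ h : ℕ → Term, (∀ a ∈ t.head, a.inst h ∈ I) ∧ ∀ x ∈ t.frontier, h x = g x

/-- `I` is a model of the set `T` of TGDs. -/
def IsModel (I : Inst) (T : List TGD) : Prop := ∀ t ∈ T, TGD.Satisfies I t

/-- Number of (distinct) variables in the body of a TGD. -/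
def TGD.bodyVarList (t : TGD) : List ℕ := ((t.body.map Atom.args).flatten).dedup

/-- The body width of a set of TGDs. -/
def bodyWidth (T : List TGD) : ℕ := (T.map (fun t => t.bodyVarList.length)).foldr max 0

/-! ### The chase -/

/-- `ϑ` is applicable at tuple `c̄` in `I`. -/
def TGD.Applicable (t : TGD) (I : Inst) (c : List Term) : Prop :=
  (∃ g : ℕ → Term, (∀ a ∈ t.body, a.inst g ∈ I) ∧ t.frontier.map g = c) ∧
  ¬ (∃ h : ℕ → Term, (∀ a ∈ t.head, a.inst h ∈ I) ∧ t.frontier.map h = c)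

/-- `J` is the result of applying `ϑ` in `I` at `c̄`: the head is added, with the
existential variables replaced by distinct fresh nulls. -/
def TGD.StepResult (t : TGD) (I : Inst) (c : List Term) (J : Inst) : Prop :=
  ∃ h : ℕ → Term,
    t.frontier.map h = c ∧
    (∀ x, x ∈ t.headVars → x ∉ t.frontier → (¬ (h x).isConst ∧ h x ∉ adom I)) ∧
    (∀ x y, x ∈ t.headVars → y ∈ t.headVars → x ∉ t.frontier → y ∉ t.frontier →
      h x = h y → x = y) ∧
    J = I ∪ { f | ∃ a ∈ t.head, f = a.inst h }

/-- A chase step from `I` to `J` with some TGD of `T`. -/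
def ChaseStep (T : List TGD) (I J : Inst) : Prop :=
  ∃ t ∈ T, ∃ c, t.Applicable I c ∧ t.StepResult I c J

/-- A chase sequence for `I` with `T` (stalling when no TGD is applicable). -/
def IsChaseSeq (T : List TGD) (I : Inst) (f : ℕ → Inst) : Prop :=
  f 0 = I ∧ ∀ i, ChaseStep T (f i) (f (i+1)) ∨ ((¬ ∃ J, ChaseStep T (f i) J) ∧ f (i+1) = f i)

/-- Fairness: every applicable TGD application is eventually performed or becomes
non-applicable. -/
def IsFair (T : List TGD) (f : ℕ → Inst) : Prop :=
  ∀ i, ∀ t ∈ T, ∀ c, TGD.Applicable t (f i) c →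
    ∃ j, i ≤ j ∧
      ((TGD.Applicable t (f j) c ∧ TGD.StepResult t (f j) c (f (j+1))) ∨
        ¬ TGD.Applicable t (f j) c)

/-- `J` is the result of some fair chase sequence for `I` with `T`. -/
def IsChaseResult (T : List TGD) (I J : Inst) : Prop :=
  ∃ f : ℕ → Inst, IsChaseSeq T I f ∧ IsFair T f ∧ J = ⋃ i, f i

/-- `chase T I`: the result of an arbitrary but fixed fair chase sequence for `I` with `T`. -/
noncomputable def chase (T : List TGD) (I : Inst) : Inst :=
  @dite _ (∃ J, IsChaseResult T I J) (Classical.dec _) (fun h => h.choose) (fun _ => I)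

/-! ### Query answering w.r.t. TGDs and conservativity notions -/

/-- `c̄ ∈ q_T(D)`: `c̄` is a tuple over `adom D` and an answer to `q` on `chase T D`. -/
def AnswerWrt (q : CQ) (T : List TGD) (D : Inst) (c : List Term) : Prop :=
  (∀ x ∈ c, x ∈ adom D) ∧ ∃ h, CQHom q (chase T D) h ∧ q.ans.map h = c

/-- `T2` is `ΣD,ΣQ`-hom-conservative over `T1`. -/
def HomConservative (T1 T2 : List TGD) (SD SQ : Schema) : Prop :=
  ∀ D, IsDatabase D SD → HomTo SQ (chase T2 D) (chase T1 D)

/-- `T2` is `ΣD,ΣQ`-CQ-conservative over `T1`. -/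
def CQConservative (T1 T2 : List TGD) (SD SQ : Schema) : Prop :=
  ∀ D, IsDatabase D SD → ∀ q : CQ, CQ.Over q SQ →
    ∀ c, AnswerWrt q T2 D c → AnswerWrt q T1 D c

/-- `T` is `ΣD,ΣQ`-hom-trivial. -/
def HomTrivial (T : List TGD) (SD SQ : Schema) : Prop :=
  ∀ D, IsDatabase D SD → HomTo SQ (chase T D) D

/-- `T` is `ΣD,ΣQ`-CQ-trivial. -/
def CQTrivial (T : List TGD) (SD SQ : Schema) : Prop :=
  ∀ D, IsDatabase D SD → ∀ q : CQ, CQ.Over q SQ →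
    ∀ c, AnswerWrt q T D c → IsAnswer q D c

/-! ### Basic facts on instantiation and mapping -/

theorem Atom.inst_map (w : Term → Term) (g : ℕ → Term) (a : Atom) :
    (a.inst g).map w = a.inst (w ∘ g) := by
  simp [Atom.inst, Fct.map]

theorem Fct.map_map (w v : Term → Term) (f : Fct) : (f.map v).map w = f.map (w ∘ v) := by
  simp [Fct.map]

theorem Fct.map_congr {w v : Term → Term} {f : Fct} (h : ∀ τ ∈ f.args, w τ = v τ) :
    f.map w = f.map v := by
  simpa [Fct.map] using h

theorem Fct.map_id' {w : Term → Term} {f : Fct} (h : ∀ τ ∈ f.args, w τ = τ) : f.map w = f := by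
  rw [Fct.map_congr (v := id) (by simpa using h)]
  simp [Fct.map]

theorem Atom.inst_congr {g g' : ℕ → Term} {a : Atom} (h : ∀ x ∈ a.args, g x = g' x) :
    a.inst g = a.inst g' := by
  simpa [Atom.inst] using h

theorem mem_args_inst {a : Atom} {g : ℕ → Term} {x : ℕ} (hx : x ∈ a.args) :
    g x ∈ (a.inst g).args := by
  simp only [Atom.inst]
  exact List.mem_map_of_mem hx

theorem finite_adom {I : Inst} (hI : I.Finite) : (adom I).Finite := by
  have : adom I = ⋃ f ∈ I, { τ | τ ∈ f.args } := by ext; simp [adom]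
  rw [this]
  exact hI.biUnion fun f _ => f.args.finite_toSet

/-! ### Existence of fair chase sequences -/

theorem exists_null_bound {S : Set Term} (hS : S.Finite) :
    ∃ M : ℕ, ∀ n, Term.null n ∈ S → n < M := by
  have h : (Term.null ⁻¹' S).Finite :=
    hS.preimage (fun a _ b _ h => by simpa using h)
  obtain ⟨M, hM⟩ := h.bddAbove
  exact ⟨M + 1, fun n hn => Nat.lt_succ_of_le (hM hn)⟩

theorem TGD.Applicable.exists_stepResult {t : TGD} {I : Inst} {c : List Term}
    (h : t.Applicable I c) (hI : I.Finite) : ∃ J, t.StepResult I c J ∧ J.Finite := by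
  obtain ⟨⟨g, -, hc⟩, -⟩ := h
  obtain ⟨M, hM⟩ := exists_null_bound (finite_adom hI)
  let k : ℕ → Term := fun x => if x ∈ t.frontier then g x else Term.null (M + x)
  refine ⟨_, ⟨k, ?_, ?_, ?_, rfl⟩, ?_⟩
  · rw [← hc]
    refine List.map_congr_left fun x hx => by simp [k, hx]
  · intro x _ hx
    simp only [k, hx, if_false, Term.isConst, not_false_eq_true, true_and]
    intro hmem
    have := hM _ hmem
    omega
  · intro x y _ _ hx hy hxy
    simpa [k, hx, hy] using hxy
  · refine hI.union ?_
    have : { f | ∃ a ∈ t.head, f = a.inst k } = (Atom.inst k) '' { a | a ∈ t.head } := by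
      ext; simp [eq_comm]
    rw [this]
    exact t.head.finite_toSet.image _

theorem TGD.StepResult.subset {t : TGD} {I J : Inst} {c : List Term} (h : t.StepResult I c J) :
    I ⊆ J := by
  obtain ⟨k, -, -, -, rfl⟩ := h
  exact Set.subset_union_left

theorem TGD.StepResult.not_applicable {t : TGD} {I J J' : Inst} {c : List Term}
    (h : t.StepResult I c J) (hJ : J ⊆ J') : ¬ t.Applicable J' c := by
  obtain ⟨k, hc, -, -, rfl⟩ := h
  exact fun h' => h'.2 ⟨k, fun a ha => hJ (Or.inr ⟨a, ha, rfl⟩), hc⟩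

theorem exists_least_chaseStep (T : List TGD) (I : { I : Inst // I.Finite }) :
    ∃ J : { I : Inst // I.Finite },
      ((¬ ∃ t ∈ T, ∃ c, t.Applicable I.1 c) ∧ J = I) ∨
      ∃ t ∈ T, ∃ c, t.Applicable I.1 c ∧ t.StepResult I.1 c J.1 ∧
        ∀ t' ∈ T, ∀ c', t'.Applicable I.1 c' →
          Encodable.encode (t, c) ≤ Encodable.encode (t', c') := by
  classical
  by_cases h : ∃ t ∈ T, ∃ c, t.Applicable I.1 c
  · have h' : ∃ n, ∃ t ∈ T, ∃ c, t.Applicable I.1 c ∧ Encodable.encode (t, c) = n := by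
      obtain ⟨t, ht, c, hc⟩ := h
      exact ⟨_, t, ht, c, hc, rfl⟩
    obtain ⟨t, ht, c, hc, hn⟩ := Nat.find_spec h'
    obtain ⟨J, hJ, hfin⟩ := hc.exists_stepResult I.2
    refine ⟨⟨J, hfin⟩, Or.inr ⟨t, ht, c, hc, hJ, fun t' ht' c' hc' => ?_⟩⟩
    rw [hn]
    exact Nat.find_min' h' ⟨t', ht', c', hc', rfl⟩
  · exact ⟨I, Or.inl ⟨h, rfl⟩⟩

theorem exists_isChaseResult (T : List TGD) {D : Inst} (hD : D.Finite) :
    ∃ J, IsChaseResult T D J := by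
  choose next hnext using exists_least_chaseStep T
  let F : ℕ → { I : Inst // I.Finite } := fun i => next^[i] ⟨D, hD⟩
  have hF : ∀ i, F (i + 1) = next (F i) := fun i => Function.iterate_succ_apply' _ _ _
  have hmono : Monotone fun i => (F i).1 := by
    refine monotone_nat_of_le_succ fun i => ?_
    rw [hF]
    obtain ⟨-, h⟩ | ⟨t, -, c, -, h, -⟩ := hnext (F i)
    · rw [h]
    · exact h.subset
  refine ⟨_, fun i => (F i).1, ⟨rfl, fun i => ?_⟩, ?_, rfl⟩
  · simp only [hF]
    obtain ⟨hno, h⟩ | ⟨t, ht, c, hc, h, -⟩ := hnext (F i)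
    · refine Or.inr ⟨?_, by rw [h]⟩
      rintro ⟨J, t, ht, c, hc, -⟩
      exact hno ⟨t, ht, c, hc⟩
    · exact Or.inl ⟨t, ht, c, hc, h⟩
  · intro i t ht c hc
    by_contra! hcon
    have hstep : ∀ d, ∃ p : TGD × List Term, p.1.StepResult (F (i + d)).1 p.2 (F (i + d + 1)).1 ∧
        p.1.Applicable (F (i + d)).1 p.2 ∧
        Encodable.encode p < Encodable.encode (t, c) := by
      intro d
      obtain ⟨h1, h2⟩ := hcon (i + d) (by omega)
      obtain ⟨hno, -⟩ | ⟨t', ht', c', hc', h, hmin⟩ := hnext (F (i + d))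
      · exact absurd ⟨t, ht, c, h2⟩ hno
      · refine ⟨(t', c'), by rw [hF]; exact h, hc', lt_of_le_of_ne (hmin t ht c h2) fun heq => ?_⟩
        obtain ⟨rfl, rfl⟩ := Prod.ext_iff.1 (Encodable.encode_injective heq)
        exact h1 h2 (by rw [hF]; exact h)
    choose p hp1 hp2 hp3 using hstep
    have hlt : ∀ d d', d < d' → p d ≠ p d' := by
      intro d d' hdd heq
      refine (hp1 d).not_applicable (hmono (show i + d + 1 ≤ i + d' by omega)) ?_
      rw [heq]
      exact hp2 d'
    have hinj : Function.Injective fun d => Encodable.encode (p d) := by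
      intro d d' h
      have h := Encodable.encode_injective h
      rcases lt_trichotomy d d' with hd | hd | hd
      · exact absurd h (hlt _ _ hd)
      · exact hd
      · exact absurd h.symm (hlt _ _ hd)
    exact Set.infinite_of_injective_forall_mem hinj
      (s := Set.Iio (Encodable.encode (t, c))) hp3 (Set.finite_Iio _)

/-! ### The chase is a universal model -/

theorem IsChaseSeq.monotone {T : List TGD} {I : Inst} {f : ℕ → Inst} (h : IsChaseSeq T I f) :
    Monotone f := by
  refine monotone_nat_of_le_succ fun i => ?_
  obtain ⟨t, -, c, -, h⟩ | ⟨-, h⟩ := h.2 i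
  · exact h.subset
  · rw [h]

theorem IsChaseResult.subset {T : List TGD} {I J : Inst} (h : IsChaseResult T I J) : I ⊆ J := by
  obtain ⟨f, hf, -, rfl⟩ := h
  exact hf.1 ▸ Set.subset_iUnion f 0

theorem IsChaseResult.isModel {T : List TGD} {I J : Inst} (h : IsChaseResult T I J) :
    IsModel J T := by
  obtain ⟨f, hf, hfair, rfl⟩ := h
  intro t ht g hg
  have hbody : ∃ i, ∀ a ∈ t.body, a.inst g ∈ f i := by
    have : ∀ l : List Atom, (∀ a ∈ l, a.inst g ∈ ⋃ i, f i) → ∃ i, ∀ a ∈ l, a.inst g ∈ f i := by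
      intro l
      induction l with
      | nil => simp
      | cons a l ih =>
        intro hl
        obtain ⟨i, hi⟩ := ih fun b hb => hl b (List.mem_cons_of_mem _ hb)
        obtain ⟨j, hj⟩ := Set.mem_iUnion.1 (hl a List.mem_cons_self)
        refine ⟨max i j, fun b hb => ?_⟩
        rcases List.mem_cons.1 hb with rfl | hb
        · exact hf.monotone (le_max_right i j) hj
        · exact hf.monotone (le_max_left i j) (hi b hb)
    exact this _ hg
  obtain ⟨i, hi⟩ := hbody
  suffices h : ∃ j, ∃ k : ℕ → Term,
      (∀ a ∈ t.head, a.inst k ∈ f j) ∧ t.frontier.map k = t.frontier.map g by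
    obtain ⟨j, k, hk, hkg⟩ := h
    exact ⟨k, fun a ha => Set.mem_iUnion.2 ⟨j, hk a ha⟩, by simpa using hkg⟩
  by_cases hc : t.Applicable (f i) (t.frontier.map g)
  · obtain ⟨j, hij, ⟨-, k, hk, -, -, hJ⟩ | hna⟩ := hfair i t ht _ hc
    · exact ⟨j + 1, k, fun a ha => hJ ▸ Or.inr ⟨a, ha, rfl⟩, hk⟩
    · by_contra! hno
      exact hna ⟨⟨g, fun a ha => hf.monotone hij (hi a ha), rfl⟩,
        fun ⟨k, hk, hkg⟩ => hno j k hk hkg⟩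
  · by_contra! hno
    exact hc ⟨⟨g, hi, rfl⟩, fun ⟨k, hk, hkg⟩ => hno i k hk hkg⟩

theorem TGD.StepResult.exists_extend_hom {t : TGD} (ht : t.wf) {I J M : Inst} {c : List Term}
    (hM : t.Satisfies M) (hc : t.Applicable I c) (hJ : t.StepResult I c J) {u : Term → Term}
    (hu : DBPres u) (huI : IsFullHom u I M) :
    ∃ v, DBPres v ∧ IsFullHom v J M ∧ ∀ τ ∈ adom I, v τ = u τ := by
  classical
  obtain ⟨⟨g, hg, rfl⟩, -⟩ := hc
  obtain ⟨k, hk, hfresh, hinj, rfl⟩ := hJ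
  obtain ⟨e, he, hef⟩ := hM (u ∘ g) fun a ha => by
    rw [← Atom.inst_map]; exact huI _ (hg a ha)
  have hk' : ∀ x ∈ t.frontier, k x = g x := by simpa using hk
  have hgad : ∀ x ∈ t.frontier, g x ∈ adom I := fun x hx => by
    obtain ⟨a, ha, hxa⟩ := ht.2.2.2.1 x hx
    exact ⟨_, hg a ha, mem_args_inst hxa⟩
  let P : Term → ℕ → Prop := fun τ x => x ∈ t.headVars ∧ x ∉ t.frontier ∧ k x = τ
  let v : Term → Term := fun τ => if h : ∃ x, P τ x then e h.choose else u τ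
  have hvI : ∀ τ ∈ adom I, v τ = u τ := fun τ hτ => by
    refine dif_neg ?_
    rintro ⟨x, hx1, hx2, rfl⟩
    exact (hfresh x hx1 hx2).2 hτ
  have hvk : ∀ x ∈ t.headVars, v (k x) = e x := fun x hx => by
    by_cases hxf : x ∈ t.frontier
    · rw [hk' x hxf, hvI _ (hgad x hxf), hef x hxf]; rfl
    · have h : ∃ y, P (k x) y := ⟨x, hx, hxf, rfl⟩
      have hs := h.choose_spec
      have : h.choose = x := hinj _ _ hs.1 hx hs.2.1 hxf hs.2.2
      simp only [v, dif_pos h, this]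
  refine ⟨v, fun n => ?_, ?_, hvI⟩
  · refine (dif_neg ?_).trans (hu n)
    rintro ⟨x, hx1, hx2, hx3⟩
    exact (hfresh x hx1 hx2).1 (by rw [hx3]; trivial)
  · rintro f (hf | ⟨a, ha, rfl⟩)
    · rw [Fct.map_congr fun τ hτ => hvI τ ⟨f, hf, hτ⟩]
      exact huI f hf
    · rw [Atom.inst_map, Atom.inst_congr (g := v ∘ k) (g' := e) fun x hx => hvk x ⟨a, ha, hx⟩]
      exact he a ha

theorem IsChaseResult.exists_hom {T : List TGD} (hT : ∀ t ∈ T, t.wf) {D J M : Inst}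
    (hJ : IsChaseResult T D J) (hM : IsModel M T) (hDM : D ⊆ M) :
    ∃ u, DBPres u ∧ IsFullHom u J M := by
  classical
  obtain ⟨f, hf, -, rfl⟩ := hJ
  have hstep : ∀ i (u : { u // DBPres u ∧ IsFullHom u (f i) M }),
      ∃ v : { u // DBPres u ∧ IsFullHom u (f (i + 1)) M }, ∀ τ ∈ adom (f i), v.1 τ = u.1 τ := by
    rintro i ⟨u, hu, hui⟩
    obtain ⟨t, ht, c, hc, hstep⟩ | ⟨-, h⟩ := hf.2 i
    · obtain ⟨v, h1, h2, h3⟩ := hstep.exists_extend_hom (hT t ht) (hM t ht) hc hu hui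
      exact ⟨⟨v, h1, h2⟩, h3⟩
    · exact ⟨⟨u, hu, by rw [h]; exact hui⟩, fun _ _ => rfl⟩
  choose step hstep using hstep
  let H : ∀ i, { u // DBPres u ∧ IsFullHom u (f i) M } := fun i =>
    Nat.rec ⟨id, fun _ => rfl, fun A hA => by
      rw [Fct.map_id' (w := id) fun _ _ => rfl]; exact hDM (hf.1 ▸ hA)⟩ step i
  have hH : ∀ i τ, τ ∈ adom (f i) → (H (i + 1)).1 τ = (H i).1 τ := fun i τ hτ => hstep i (H i) τ hτ
  have hH' : ∀ i j τ, i ≤ j → τ ∈ adom (f i) → (H j).1 τ = (H i).1 τ := by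
    intro i j τ hij hτ
    induction j, hij using Nat.le_induction with
    | base => rfl
    | succ j hij ih =>
      rw [hH, ih]
      obtain ⟨A, hA, hτA⟩ := hτ
      exact ⟨A, hf.monotone hij hA, hτA⟩
  refine ⟨fun τ => if h : ∃ i, τ ∈ adom (f i) then (H (Nat.find h)).1 τ else τ, fun n => ?_, ?_⟩
  · dsimp only
    split_ifs with h
    · exact (H _).2.1 n
    · rfl
  · intro A hA
    obtain ⟨i, hi⟩ := Set.mem_iUnion.1 hA
    rw [Fct.map_congr (v := (H i).1)]
    · exact (H i).2.2 A hi
    · intro τ hτ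
      have h : ∃ i, τ ∈ adom (f i) := ⟨i, A, hi, hτ⟩
      rw [dif_pos h, hH' _ _ _ (Nat.find_min' h ⟨A, hi, hτ⟩) (Nat.find_spec h)]

theorem isChaseResult_chase (T : List TGD) {D : Inst} (hD : D.Finite) :
    IsChaseResult T D (chase T D) := by
  have h := exists_isChaseResult T hD
  rw [chase, dif_pos h]
  exact h.choose_spec

/-! ### Labelled models witnessing triviality -/

/-- The label of a term: constants are their own label, and the null coded by a pair `(l, c)` is a
copy of the constant `l`. -/
def Term.label : Term → Term
  | .const n => .const n
  | .null m => .const m.unpair.1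

/-- `D` extends to a model of `T` that is folded back onto `D` by the labelling. -/
def HasFoldedModel (T : List TGD) (S : Schema) (D : Inst) : Prop :=
  ∃ J : Inst, D ⊆ J ∧ IsModel J T ∧ IsHomOn S Term.label J D

theorem HasFoldedModel.homTo {T : List TGD} (hT : ∀ t ∈ T, t.wf) {S : Schema} {D : Inst}
    (hD : D.Finite) (h : HasFoldedModel T S D) : HomTo S (chase T D) D := by
  obtain ⟨J, hDJ, hJ, hlab⟩ := h
  obtain ⟨u, hu, huJ⟩ := (isChaseResult_chase T hD).exists_hom hT hJ hDJ
  refine ⟨Term.label ∘ u, fun n => by simp [hu n, Term.label], fun A hA hAS => ?_⟩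
  rw [← Fct.map_map]
  exact hlab _ (huJ A hA) hAS

theorem hasFoldedModel_of_singletons {T : List TGD} (hT : ∀ t ∈ T, t.Linear) {S : Schema}
    {D : Inst} (h0 : HasFoldedModel T S ∅) (h1 : ∀ A ∈ D, HasFoldedModel T S {A}) :
    HasFoldedModel T S D := by
  obtain ⟨J₀, -, hJ₀, hlab₀⟩ := h0
  choose! J hDJ hJ hlab using h1
  refine ⟨J₀ ∪ ⋃ A ∈ D, J A, fun A hA => Or.inr ?_, fun t ht g hg => ?_, ?_⟩
  · exact Set.mem_biUnion hA (hDJ A hA rfl)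
  · have key : ∀ K : Inst, IsModel K T → K ⊆ J₀ ∪ ⋃ A ∈ D, J A → (∀ a ∈ t.body, a.inst g ∈ K) →
        ∃ h : ℕ → Term, (∀ a ∈ t.head, a.inst h ∈ J₀ ∪ ⋃ A ∈ D, J A) ∧
          ∀ x ∈ t.frontier, h x = g x := fun K hK hsub hKg => by
      obtain ⟨h, hh, hf⟩ := hK t ht g hKg
      exact ⟨h, fun a ha => hsub (hh a ha), hf⟩
    have hlin := hT t ht
    unfold TGD.Linear at hlin
    match hb : t.body with
    | [] => exact key J₀ hJ₀ Set.subset_union_left (by simp [hb])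
    | a :: b :: l => simp [hb] at hlin
    | [a] =>
      rcases hg a (by simp [hb]) with ha | ha
      · exact key J₀ hJ₀ Set.subset_union_left (by simpa [hb] using ha)
      · obtain ⟨A, hA, haA⟩ := Set.mem_iUnion₂.1 ha
        refine key (J A) (hJ A hA) (fun B hB => Or.inr (Set.mem_biUnion hA hB)) ?_
        simpa [hb] using haA
  · rintro B (hB | hB) hBS
    · exact (hlab₀ B hB hBS).elim
    · obtain ⟨A, hA, hBA⟩ := Set.mem_iUnion₂.1 hB
      have := hlab A hA B hBA hBS
      rw [Set.mem_singleton_iff] at this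
      exact this ▸ hA

theorem IsModel.image {T : List TGD} (hT : ∀ t ∈ T, t.wf) {J : Inst} (hJ : IsModel J T)
    {π : Term → Term} (hπ : Function.Injective π) : IsModel (Fct.map π '' J) T := by
  intro t ht g hg
  have : Nonempty Term := ⟨.const 0⟩
  have hinv : ∀ τ, Function.invFun π (π τ) = τ := Function.leftInverse_invFun hπ
  obtain ⟨h, hh, hf⟩ := hJ t ht (Function.invFun π ∘ g) fun a ha => by
    obtain ⟨A, hA, hAa⟩ := hg a ha
    rw [← Atom.inst_map, ← hAa, Fct.map_map, Fct.map_id' (w := Function.invFun π ∘ π) fun τ _ => hinv τ]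
    exact hA
  refine ⟨π ∘ h, fun a ha => ⟨_, hh a ha, Atom.inst_map _ _ _⟩, fun x hx => ?_⟩
  obtain ⟨a, ha, hxa⟩ := (hT t ht).2.2.2.1 x hx
  obtain ⟨A, -, hAa⟩ := hg a ha
  have hmem : g x ∈ (A.map π).args := hAa ▸ mem_args_inst hxa
  obtain ⟨τ, -, hτ⟩ := List.mem_map.1 hmem
  simp [hf x hx, ← hτ, hinv]

theorem HasFoldedModel.image {T : List TGD} (hT : ∀ t ∈ T, t.wf) {S : Schema} {D : Inst}
    (h : HasFoldedModel T S D) {π : Term → Term} (hπ : Function.Injective π)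
    (hlab : ∀ τ, (π τ).label = π τ.label) : HasFoldedModel T S (Fct.map π '' D) := by
  obtain ⟨J, hDJ, hJ, hJlab⟩ := h
  refine ⟨Fct.map π '' J, Set.image_mono hDJ, hJ.image hT hπ, ?_⟩
  rintro _ ⟨A, hA, rfl⟩ hAS
  refine ⟨_, hJlab A hA hAS, ?_⟩
  rw [Fct.map_map, Fct.map_map]
  exact Fct.map_congr fun τ _ => (hlab τ).symm

/-- Renaming of terms induced by a renaming of constants. -/
def Term.rename (k : ℕ → ℕ) : Term → Term
  | .const n => .const (k n)
  | .null m => .null (Nat.pair (k m.unpair.1) m.unpair.2)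

theorem Term.rename_injective {k : ℕ → ℕ} (hk : Function.Injective k) :
    Function.Injective (Term.rename k) := by
  rintro (n | n) (m | m) h
  · simpa [Term.rename, hk.eq_iff] using h
  · simp [Term.rename] at h
  · simp [Term.rename] at h
  · simp only [Term.rename, Term.null.injEq, Nat.pair_eq_pair, hk.eq_iff] at h
    rw [← Nat.pair_unpair n, ← Nat.pair_unpair m, h.1, h.2]

theorem Term.label_rename (k : ℕ → ℕ) (τ : Term) : (τ.rename k).label = τ.label.rename k := by
  cases τ <;> simp [Term.rename, Term.label]

/-- A fact over constants is, up to an injective renaming of constants, a fact whose arguments are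
positions of its tuple. -/
theorem exists_rename_eq {A : Fct} (hA : ∀ τ ∈ A.args, τ.isConst) :
    ∃ s : List ℕ, s.length = A.args.length ∧ (∀ n ∈ s, n < A.args.length) ∧
      ∃ k : ℕ → ℕ, Function.Injective k ∧
        (⟨A.rel, s.map Term.const⟩ : Fct).map (Term.rename k) = A := by
  classical
  obtain ⟨R, l⟩ := A
  simp only at hA ⊢
  obtain ⟨l, rfl⟩ : ∃ l' : List ℕ, l = l'.map Term.const := by
    induction l with
    | nil => exact ⟨[], rfl⟩
    | cons τ l ih =>
      obtain ⟨l', rfl⟩ := ih fun τ hτ => hA τ (List.mem_cons_of_mem _ hτ)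
      have := hA τ List.mem_cons_self
      cases τ with
      | const n => exact ⟨n :: l', rfl⟩
      | null n => exact this.elim
  let s := l.map fun c => l.idxOf c
  let k : ℕ → ℕ := fun n => if n ∈ s then l.getD n 0 else l.sum + 1 + n
  have hk : ∀ c ∈ l, k (l.idxOf c) = c := fun c hc => by
    have : l.idxOf c ∈ s := List.mem_map_of_mem (f := fun c => l.idxOf c) hc
    simp [k, this, List.idxOf_lt_length_of_mem hc]
  refine ⟨s, by simp [s], fun n hn => ?_, k, ?_, ?_⟩
  · obtain ⟨c, hc, rfl⟩ := List.mem_map.1 hn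
    simpa using List.idxOf_lt_length_of_mem hc
  · have hle : ∀ c ∈ l, c ≤ l.sum := fun c hc => List.le_sum_of_mem hc
    intro n m hnm
    by_cases hn : n ∈ s <;> by_cases hm : m ∈ s
    · obtain ⟨c, hc, rfl⟩ := List.mem_map.1 hn
      obtain ⟨d, hd, rfl⟩ := List.mem_map.1 hm
      rw [hk c hc, hk d hd] at hnm
      rw [hnm]
    · obtain ⟨c, hc, rfl⟩ := List.mem_map.1 hn
      rw [hk c hc] at hnm
      simp only [k, hm, if_false] at hnm
      have := hle c hc
      omega
    · obtain ⟨d, hd, rfl⟩ := List.mem_map.1 hm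
      rw [hk d hd] at hnm
      simp only [k, hn, if_false] at hnm
      have := hle d hd
      omega
    · simp only [k, hn, hm, if_false] at hnm
      omega
  · simp only [Fct.map, List.map_map, s, Fct.mk.injEq, true_and]
    refine List.map_congr_left fun c hc => ?_
    simp [Term.rename, hk c hc]

/-! ### A bounded search space for folded models -/

/-- All lists of length `n` over `E`. -/
def tuples {α : Type} (E : List α) (n : ℕ) : List (List α) :=
  Nat.rec [[]] (fun _ L => L.flatMap fun s => E.map fun e => e :: s) n

theorem mem_tuples {α : Type} {E : List α} {n : ℕ} {s : List α} :
    s ∈ tuples E n ↔ s.length = n ∧ ∀ e ∈ s, e ∈ E := by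
  induction n generalizing s with
  | zero => simp +contextual [tuples]
  | succ n ih =>
    change s ∈ (tuples E n).flatMap _ ↔ _
    simp only [List.mem_flatMap, List.mem_map, ih]
    constructor
    · rintro ⟨s', ⟨h1, h2⟩, e, he, rfl⟩
      simp [h1, he]
      exact h2
    · rintro ⟨h1, h2⟩
      cases s with
      | nil => simp at h1
      | cons e s =>
        exact ⟨s, ⟨by simpa using h1, fun x hx => h2 x (List.mem_cons_of_mem _ hx)⟩, e,
          h2 e List.mem_cons_self, rfl⟩

/-- All lists obtained from `l` by deleting entries. -/
def selections {α : Type} (l : List α) : List (List α) :=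
  l.foldr (fun a L => L ++ L.map fun s => a :: s) [[]]

theorem mem_selections {α : Type} {l s : List α} : s ∈ selections l ↔ s.Sublist l := by
  induction l generalizing s with
  | nil => simp [selections]
  | cons a l ih =>
    change s ∈ selections l ++ (selections l).map _ ↔ _
    simp only [List.mem_append, List.mem_map, ih, List.sublist_cons_iff]
    simp only [and_comm, eq_comm]

/-- The terms used in bounded folded models: `N` constants, and `2 * N` null copies of each. -/
def boundedTerms (N : ℕ) : List Term :=
  (List.range N).map Term.const ++
    (List.range N).flatMap fun l => (List.range (2 * N)).map fun c => Term.null (Nat.pair l c)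

theorem const_mem_boundedTerms {N n : ℕ} : Term.const n ∈ boundedTerms N ↔ n < N := by
  simp [boundedTerms]

theorem null_mem_boundedTerms {N l c : ℕ} :
    Term.null (Nat.pair l c) ∈ boundedTerms N ↔ l < N ∧ c < 2 * N := by
  simp [boundedTerms]

/-- The numbers occurring as variables in a TGD. -/
def TGD.vars (t : TGD) : List ℕ :=
  t.body.flatMap Atom.args ++ (t.head.flatMap Atom.args ++ t.frontier)

/-- A bound on all variables of the TGDs and the arities of the schema. -/
def sizeBound (T : List TGD) (SD : List RelSym) : ℕ :=
  (T.flatMap TGD.vars ++ SD.map RelSym.arity).sum + 1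

theorem lt_sizeBound_of_mem_vars {T : List TGD} {SD : List RelSym} {t : TGD} (ht : t ∈ T) {x : ℕ}
    (hx : x ∈ t.vars) : x < sizeBound T SD :=
  Nat.lt_succ_of_le <| List.le_sum_of_mem <|
    List.mem_append_left _ <| List.mem_flatMap.2 ⟨t, ht, hx⟩

theorem arity_lt_sizeBound {T : List TGD} {SD : List RelSym} {R : RelSym} (hR : R ∈ SD) :
    R.arity < sizeBound T SD :=
  Nat.lt_succ_of_le <| List.le_sum_of_mem <| List.mem_append_right _ <| List.mem_map_of_mem hR

/-- The facts over bounded terms with relation symbols from the schema or from a head. -/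
def boundedFacts (T : List TGD) (SD : List RelSym) : List Fct :=
  ((T.flatMap fun t => t.head.map Atom.rel) ++ SD).flatMap fun R =>
    (tuples (boundedTerms (sizeBound T SD)) R.arity).map fun s => ⟨R, s⟩

theorem mem_boundedFacts {T : List TGD} {SD : List RelSym} {A : Fct} :
    A ∈ boundedFacts T SD ↔ ((∃ t ∈ T, ∃ a ∈ t.head, a.rel = A.rel) ∨ A.rel ∈ SD) ∧
      A.args.length = A.rel.arity ∧ ∀ τ ∈ A.args, τ ∈ boundedTerms (sizeBound T SD) := by
  obtain ⟨R, s⟩ := A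
  simp only [boundedFacts, List.mem_flatMap, List.mem_append, List.mem_map, mem_tuples]
  constructor
  · rintro ⟨R', hR, s', hs, h⟩
    obtain ⟨rfl, rfl⟩ := Fct.mk.injEq .. ▸ h
    exact ⟨hR, hs⟩
  · rintro ⟨hR, hs⟩
    exact ⟨R, hR, s, hs, rfl⟩

/-- The assignment listed by `s`. -/
def assignment (s : List Term) (x : ℕ) : Term := s.getD x (.const 0)

theorem assignment_map_range {N : ℕ} (g : ℕ → Term) {x : ℕ} (hx : x < N) :
    assignment ((List.range N).map g) x = g x := by
  simp [assignment, hx]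

/-- Satisfaction of a TGD with respect to assignments of the variables below `N` to `E`. -/
def TGD.SatisfiesWithin (E : List Term) (N : ℕ) (J : List Fct) (t : TGD) : Prop :=
  ∀ s ∈ tuples E N, (∀ a ∈ t.body, a.inst (assignment s) ∈ J) →
    ∃ s' ∈ tuples E N, (∀ a ∈ t.head, a.inst (assignment s') ∈ J) ∧
      ∀ x ∈ t.frontier, assignment s' x = assignment s x

/-- `D` has a folded model in the bounded search space. -/
def HasBoundedModel (T : List TGD) (SD SQ : List RelSym) (D : List Fct) : Prop :=
  ∃ J ∈ selections (boundedFacts T SD), (∀ A ∈ D, A ∈ J) ∧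
    (∀ t ∈ T, t.SatisfiesWithin (boundedTerms (sizeBound T SD)) (sizeBound T SD) J) ∧
    ∀ A ∈ J, A.rel ∈ SQ → A.map Term.label ∈ D

theorem HasBoundedModel.hasFoldedModel {T : List TGD} (hT : ∀ t ∈ T, t.wf) {SD SQ : List RelSym}
    {D : List Fct} (h : HasBoundedModel T SD SQ D) :
    HasFoldedModel T { r | r ∈ SQ } { A | A ∈ D } := by
  classical
  obtain ⟨J, hJ, hDJ, hsat, hlab⟩ := h
  have hJ := (mem_selections.1 hJ).subset
  set N := sizeBound T SD with hN
  have hN0 : 0 < N := Nat.succ_pos _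
  refine ⟨{ A | A ∈ J }, hDJ, fun t ht g hg => ?_, hlab⟩
  let g' : ℕ → Term := fun x => if g x ∈ boundedTerms N then g x else .const 0
  have hgg : ∀ a ∈ t.body, ∀ x ∈ a.args, assignment ((List.range N).map g') x = g x := by
    intro a ha x hx
    have hxN : x < N := lt_sizeBound_of_mem_vars ht
      (List.mem_append_left _ (List.mem_flatMap.2 ⟨a, ha, hx⟩))
    have hgx : g x ∈ boundedTerms N := (mem_boundedFacts.1 (hJ (hg a ha))).2.2 _ (mem_args_inst hx)
    rw [assignment_map_range _ hxN]
    simp [g', hgx]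
  obtain ⟨s', -, hh, hf⟩ := hsat t ht ((List.range N).map g') (mem_tuples.2 ⟨by simp, by
      intro e he
      obtain ⟨x, -, rfl⟩ := List.mem_map.1 he
      by_cases hx : g x ∈ boundedTerms N
      · simp [g', hx]
      · simpa [g', hx] using const_mem_boundedTerms.2 hN0⟩) fun a ha => by
    rw [Atom.inst_congr (hgg a ha)]
    exact hg a ha
  refine ⟨assignment s', hh, fun x hx => ?_⟩
  obtain ⟨a, ha, hxa⟩ := (hT t ht).2.2.2.1 x hx
  rw [hf x hx, hgg a ha x hxa]

theorem exists_fresh_colours (N : ℕ) (g : ℕ → Term) :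
    ∃ φ : ℕ → ℕ, (∀ x < N, φ x < 2 * N) ∧ (∀ x < N, ∀ y < N, φ x = φ y → x = y) ∧
      ∀ x < N, ∀ y < N, ∀ l, g y ≠ .null (Nat.pair l (φ x)) := by
  classical
  let colour : Term → ℕ := fun τ => match τ with
    | .const _ => 0
    | .null m => m.unpair.2
  let U := Finset.range (2 * N) \ (Finset.range N).image (colour ∘ g)
  have hU : N ≤ U.card := by
    have h1 := Finset.le_card_sdiff ((Finset.range N).image (colour ∘ g)) (Finset.range (2 * N))
    have h2 : ((Finset.range N).image (colour ∘ g)).card ≤ N := by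
      simpa using Finset.card_image_le (s := Finset.range N) (f := colour ∘ g)
    rw [Finset.card_range] at h1
    change 2 * N - _ ≤ U.card at h1
    omega
  let ψ := U.orderEmbOfCardLe hU
  have hψ : ∀ i, ψ i ∈ U := U.orderEmbOfCardLe_mem hU
  refine ⟨fun x => if h : x < N then ψ ⟨x, h⟩ else 0, fun x hx => ?_, fun x hx y hy h => ?_,
    fun x hx y hy l h => ?_⟩
  · simpa [hx] using Finset.mem_range.1 (Finset.mem_sdiff.1 (hψ ⟨x, hx⟩)).1
  · simpa [hx, hy] using h
  · refine (Finset.mem_sdiff.1 (hψ ⟨x, hx⟩)).2 (Finset.mem_image.2 ⟨y, by simpa using hy, ?_⟩)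
    simp [h, colour, hx]

theorem IsModel.hasBoundedModel {T : List TGD} (hT : ∀ t ∈ T, t.wf ∧ t.Linear)
    {SD SQ : List RelSym} {D : List Fct}
    (hD : ∀ A ∈ D, A.rel ∈ SD ∧ A.wf ∧ ∀ τ ∈ A.args, ∃ n < sizeBound T SD, τ = .const n)
    {M : Inst} (hM : IsModel M T) (hDM : ∀ A ∈ D, A ∈ M) {h : Term → Term} (hpres : DBPres h)
    (hhom : IsHomOn { r | r ∈ SQ } h M { A | A ∈ D }) : HasBoundedModel T SD SQ D := by
  classical
  set N := sizeBound T SD with hN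
  have hN0 : 0 < N := Nat.succ_pos _
  let lbl : Term → ℕ := fun τ => if h' : ∃ n < N, h τ = .const n then h'.choose else 0
  have lbl_lt : ∀ τ, lbl τ < N := fun τ => by
    by_cases h' : ∃ n < N, h τ = .const n
    · simp only [lbl, dif_pos h']
      exact h'.choose_spec.1
    · simpa only [lbl, dif_neg h']
  have lbl_eq : ∀ τ n, n < N → h τ = .const n → lbl τ = n := fun τ n hn hτ => by
    have h' : ∃ n < N, h τ = .const n := ⟨n, hn, hτ⟩
    have := h'.choose_spec.2
    simp only [lbl, dif_pos h']
    exact (Term.const.inj (hτ.symm.trans this)).symm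
  let P : Fct → (Term → Term) → Prop := fun A w =>
    A.map w ∈ M ∧ ∀ τ ∈ A.args, .const (lbl (w τ)) = τ.label
  let J := (boundedFacts T SD).filter fun A => ∃ w, P A w
  have mem_J : ∀ A, A ∈ J ↔ A ∈ boundedFacts T SD ∧ ∃ w, P A w := fun A => by simp [J]
  refine ⟨J, mem_selections.2 List.filter_sublist, fun A hA => ?_, fun t ht s hs hbody => ?_,
    fun A hA hAS => ?_⟩
  · obtain ⟨h1, h2, h3⟩ := hD A hA
    refine (mem_J A).2 ⟨mem_boundedFacts.2 ⟨Or.inr h1, h2.1, fun τ hτ => ?_⟩, id, ?_, fun τ hτ => ?_⟩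
    · obtain ⟨n, hn, rfl⟩ := h3 τ hτ
      exact const_mem_boundedTerms.2 hn
    · rw [Fct.map_id' (w := id) fun _ _ => rfl]
      exact hDM A hA
    · obtain ⟨n, hn, rfl⟩ := h3 τ hτ
      simp only [id, lbl_eq _ n hn (hpres n), Term.label]
  · set g := assignment s with hg
    obtain ⟨htwf, htlin⟩ := hT t ht
    have hgE : ∀ x < N, g x ∈ boundedTerms N := fun x hx => by
      obtain ⟨hlen, hmem⟩ := mem_tuples.1 hs
      refine hmem _ ?_
      have : x < s.length := by omega
      simp [hg, assignment, this]
    obtain ⟨w, hw⟩ : ∃ w, ∀ a ∈ t.body, P (a.inst g) w := by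
      unfold TGD.Linear at htlin
      match hb : t.body with
      | [] => exact ⟨id, by simp⟩
      | a :: b :: l => simp [hb] at htlin
      | [a] =>
        obtain ⟨w, hw⟩ := ((mem_J _).1 (hbody a (by simp [hb]))).2
        exact ⟨w, by simpa using hw⟩
    obtain ⟨e, he, hef⟩ := hM t ht (w ∘ g) fun a ha => by
      rw [← Atom.inst_map]
      exact (hw a ha).1
    obtain ⟨φ, hφ, hφinj, hφfresh⟩ := exists_fresh_colours N g
    let g' : ℕ → Term := fun x =>
      if x ∈ t.frontier then g x else .null (Nat.pair (lbl (e x)) (φ x))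
    have hfN : ∀ x ∈ t.frontier, x < N := fun x hx => lt_sizeBound_of_mem_vars ht
      (List.mem_append_right _ (List.mem_append_right _ hx))
    have hhN : ∀ a ∈ t.head, ∀ x ∈ a.args, x < N := fun a ha x hx => lt_sizeBound_of_mem_vars ht
      (List.mem_append_right _ (List.mem_append_left _ (List.mem_flatMap.2 ⟨a, ha, hx⟩)))
    have hg'E : ∀ x < N, g' x ∈ boundedTerms N := fun x hx => by
      by_cases hxf : x ∈ t.frontier
      · simpa [g', hxf] using hgE x hx
      · simpa [g', hxf] using null_mem_boundedTerms.2 ⟨lbl_lt (e x), hφ x hx⟩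
    let Q : Term → ℕ → Prop := fun τ x => x < N ∧ x ∉ t.frontier ∧ g' x = τ
    let w' : Term → Term := fun τ => if hx : ∃ x, Q τ x then e hx.choose else w τ
    have hw' : ∀ x < N, w' (g' x) = e x := fun x hx => by
      by_cases hxf : x ∈ t.frontier
      · have hno : ¬ ∃ y, Q (g' x) y := by
          rintro ⟨y, hy, hyf, hyx⟩
          simp only [g', hyf, hxf, if_true, if_false] at hyx
          exact hφfresh y hy x hx _ hyx.symm
        have : w' (g' x) = w (g' x) := dif_neg hno
        rw [this]
        simp [g', hxf, hef x hxf]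
      · have hex : ∃ y, Q (g' x) y := ⟨x, hx, hxf, rfl⟩
        have hQ : ∀ y, Q (g' x) y → y = x := by
          rintro y ⟨h1, h2, h3⟩
          simp only [g', h2, hxf, if_false, Term.null.injEq, Nat.pair_eq_pair] at h3
          exact hφinj _ h1 _ hx h3.2
        have : w' (g' x) = e hex.choose := dif_pos hex
        rw [this, hQ _ hex.choose_spec]
    have hlbl : ∀ x < N, .const (lbl (e x)) = (g' x).label := fun x hx => by
      by_cases hxf : x ∈ t.frontier
      · obtain ⟨a, ha, hxa⟩ := htwf.2.2.2.1 x hxf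
        simp only [g', hxf, if_true, hef x hxf]
        exact (hw a ha).2 _ (mem_args_inst hxa)
      · simp [g', hxf, Term.label]
    have hasg : ∀ x < N, assignment ((List.range N).map g') x = g' x := fun x hx =>
      assignment_map_range _ hx
    refine ⟨(List.range N).map g', mem_tuples.2 ⟨by simp [hN], fun τ hτ => ?_⟩, fun a ha => ?_,
      fun x hx => ?_⟩
    · obtain ⟨x, hx, rfl⟩ := List.mem_map.1 hτ
      exact hg'E x (List.mem_range.1 hx)
    · rw [Atom.inst_congr fun x hx => hasg x (hhN a ha x hx)]
      have hargs : ∀ τ ∈ (a.inst g').args, ∃ x < N, τ = g' x := fun τ hτ => by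
        obtain ⟨x, hx, rfl⟩ := List.mem_map.1 hτ
        exact ⟨x, hhN a ha x hx, rfl⟩
      refine (mem_J _).2 ⟨mem_boundedFacts.2 ⟨Or.inl ⟨t, ht, a, ha, rfl⟩, ?_, fun τ hτ => ?_⟩, w',
        ?_, fun τ hτ => ?_⟩
      · simpa [Atom.inst] using (htwf.2.1 a ha).1
      · obtain ⟨x, hx, rfl⟩ := hargs τ hτ
        exact hg'E x hx
      · rw [Atom.inst_map, Atom.inst_congr (g := w' ∘ g') (g' := e)
          fun x hx => hw' x (hhN a ha x hx)]
        exact he a ha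
      · obtain ⟨x, hx, rfl⟩ := hargs τ hτ
        rw [hw' x hx, hlbl x hx]
    · rw [hasg x (hfN x hx)]
      simp [g', hx]
  · obtain ⟨-, w, hwM, hwl⟩ := (mem_J A).1 hA
    have hmem : (A.map w).map h ∈ D := hhom _ hwM hAS
    rw [Fct.map_map] at hmem
    rw [← Fct.map_congr (w := h ∘ w) fun τ hτ => ?_]
    · exact hmem
    · obtain ⟨n, hn, hnτ⟩ := (hD _ hmem).2.2 (h (w τ)) (List.mem_map_of_mem (f := h ∘ w) hτ)
      rw [← hwl τ hτ, lbl_eq _ n hn hnτ]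
      exact hnτ

/-- Triviality only depends on the empty database and finitely many singleton databases, and for
each of these it can be tested in a bounded search space. -/
theorem homTrivial_iff {T : List TGD} (hT : ∀ t ∈ T, t.wf ∧ t.Linear) (SD SQ : List RelSym) :
    HomTrivial T { r | r ∈ SD } { r | r ∈ SQ } ↔
      HasBoundedModel T SD SQ [] ∧ ∀ R ∈ SD, 1 ≤ R.arity →
        ∀ s ∈ tuples (List.range (sizeBound T SD)) R.arity,
          HasBoundedModel T SD SQ [⟨R, s.map Term.const⟩] := by
  have hwf : ∀ t ∈ T, t.wf := fun t ht => (hT t ht).1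
  constructor
  · intro htriv
    have key : ∀ D : List Fct, (∀ A ∈ D, A.rel ∈ SD ∧ A.wf ∧
        ∀ τ ∈ A.args, ∃ n < sizeBound T SD, τ = .const n) → HasBoundedModel T SD SQ D := by
      intro D hD
      have hfin : { A | A ∈ D }.Finite := D.finite_toSet
      obtain ⟨h, hpres, hhom⟩ := htriv { A | A ∈ D }
        ⟨⟨hfin, fun A hA => ⟨(hD A hA).2.1, fun τ hτ => by
          obtain ⟨n, -, rfl⟩ := (hD A hA).2.2 τ hτ
          trivial⟩⟩, fun A hA => (hD A hA).1⟩
      have hres := isChaseResult_chase T hfin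
      exact hres.isModel.hasBoundedModel hT hD (fun A hA => hres.subset hA) hpres hhom
    refine ⟨key [] (by simp), fun R hR hRa s hs => key _ ?_⟩
    obtain ⟨hlen, hs⟩ := mem_tuples.1 hs
    simp only [List.mem_singleton, forall_eq]
    refine ⟨hR, ⟨by simpa using hlen, hRa⟩, fun τ hτ => ?_⟩
    obtain ⟨n, hn, rfl⟩ := List.mem_map.1 hτ
    exact ⟨n, List.mem_range.1 (hs n hn), rfl⟩
  · rintro ⟨h0, h1⟩ D ⟨⟨hfin, hD⟩, hDS⟩
    refine HasFoldedModel.homTo hwf hfin ?_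
    refine hasFoldedModel_of_singletons (fun t ht => (hT t ht).2) ?_ fun A hA => ?_
    · simpa using h0.hasFoldedModel hwf
    · obtain ⟨⟨hlen, har⟩, hconst⟩ := hD A hA
      obtain ⟨s, hsl, hs, k, hk, hkA⟩ := exists_rename_eq hconst
      have hbm := h1 A.rel (hDS A hA) har s (mem_tuples.2 ⟨hsl.trans hlen, fun n hn =>
        List.mem_range.2 ((hs n hn).trans (hlen ▸ arity_lt_sizeBound (hDS A hA)))⟩)
      have := (hbm.hasFoldedModel hwf).image hwf (Term.rename_injective hk) (Term.label_rename k)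
      simpa [hkA] using this

/-! ### Primitive recursiveness -/

section Primrec

variable {α β : Type} [Primcodable α] [Primcodable β]

theorem PrimrecPred.exists_mem {f : α → List β} (hf : Primrec f) {p : α → β → Prop}
    (hp : PrimrecPred fun x : α × β => p x.1 x.2) : PrimrecPred fun a => ∃ b ∈ f a, p a b :=
  (PrimrecRel.exists_mem_list (R := fun b a => p a b)
    (hp.comp (Primrec.pair Primrec.snd Primrec.fst))).comp hf Primrec.id

theorem PrimrecPred.forall_mem {f : α → List β} (hf : Primrec f) {p : α → β → Prop}
    (hp : PrimrecPred fun x : α × β => p x.1 x.2) : PrimrecPred fun a => ∀ b ∈ f a, p a b :=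
  (PrimrecRel.forall_mem_list (R := fun b a => p a b)
    (hp.comp (Primrec.pair Primrec.snd Primrec.fst))).comp hf Primrec.id

theorem PrimrecPred.imp {p q : α → Prop} (hp : PrimrecPred p) (hq : PrimrecPred q) :
    PrimrecPred fun a => p a → q a :=
  (hp.not.or hq).of_eq fun _ => imp_iff_not_or.symm

theorem PrimrecPred.mem_list {f : α → β} {l : α → List β} (hf : Primrec f) (hl : Primrec l) :
    PrimrecPred fun a => f a ∈ l a :=
  (PrimrecPred.exists_mem hl (p := fun a b => b = f a)
    (Primrec.eq.comp Primrec.snd (hf.comp Primrec.fst))).of_eq fun a => by simp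

theorem PrimrecPred.nodup {l : α → List ℕ} (hl : Primrec l) : PrimrecPred fun a => (l a).Nodup := by
  have h : PrimrecPred fun a => ∀ i ∈ List.range (l a).length, ∀ j ∈ List.range (l a).length,
      (l a).getD i 0 = (l a).getD j 0 → i = j := by
    have hr : Primrec fun a => List.range (l a).length :=
      Primrec.list_range.comp (Primrec.list_length.comp hl)
    refine .forall_mem hr (.forall_mem (hr.comp Primrec.fst) (.imp ?_ ?_))
    · exact Primrec.eq.comp
        ((Primrec.list_getD 0).comp (hl.comp (Primrec.fst.comp Primrec.fst))
          (Primrec.snd.comp Primrec.fst))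
        ((Primrec.list_getD 0).comp (hl.comp (Primrec.fst.comp Primrec.fst)) Primrec.snd)
    · exact Primrec.eq.comp (Primrec.snd.comp Primrec.fst) Primrec.snd
  refine h.of_eq fun a => ?_
  rw [List.nodup_iff_injective_get]
  constructor
  · intro h i j hij
    refine Fin.ext (h i (by simp) j (by simp) ?_)
    simpa using hij
  · intro h i hi j hj hij
    simp only [List.mem_range] at hi hj
    have := @h ⟨i, hi⟩ ⟨j, hj⟩ (by simpa [hi, hj] using hij)
    simpa using this

theorem primrec_relSym_arity : Primrec RelSym.arity :=
  Primrec.snd.comp (Primrec.of_equiv (e := relSymEquiv))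

theorem primrec_atom_rel : Primrec Atom.rel :=
  Primrec.fst.comp (Primrec.of_equiv (e := atomEquiv))

theorem primrec_atom_args : Primrec Atom.args :=
  Primrec.snd.comp (Primrec.of_equiv (e := atomEquiv))

theorem primrec_fct_rel : Primrec Fct.rel :=
  Primrec.fst.comp (Primrec.of_equiv (e := fctEquiv))

theorem primrec_fct_args : Primrec Fct.args :=
  Primrec.snd.comp (Primrec.of_equiv (e := fctEquiv))

theorem primrec_fct_mk : Primrec₂ Fct.mk :=
  Primrec.of_equiv_symm (e := fctEquiv)

theorem primrec_tgd_body : Primrec TGD.body :=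
  Primrec.fst.comp (Primrec.of_equiv (e := tgdEquiv))

theorem primrec_tgd_head : Primrec TGD.head :=
  Primrec.fst.comp (Primrec.snd.comp (Primrec.of_equiv (e := tgdEquiv)))

theorem primrec_tgd_frontier : Primrec TGD.frontier :=
  Primrec.snd.comp (Primrec.snd.comp (Primrec.of_equiv (e := tgdEquiv)))

theorem primrec_term_const : Primrec Term.const :=
  (Primrec.of_equiv_symm (e := termEquiv)).comp Primrec.sumInl

theorem primrec_term_null : Primrec Term.null :=
  (Primrec.of_equiv_symm (e := termEquiv)).comp Primrec.sumInr

theorem primrec_term_label : Primrec Term.label := by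
  refine (Primrec.sumCasesOn (Primrec.of_equiv (e := termEquiv))
    (g := fun _ n => Term.const n) (h := fun _ m => Term.const m.unpair.1)
    (primrec_term_const.comp Primrec.snd).to₂
    (primrec_term_const.comp (Primrec.fst.comp (Primrec.unpair.comp Primrec.snd))).to₂).of_eq ?_
  rintro (n | m) <;> rfl

theorem primrec_tuples : Primrec₂ (tuples (α := α)) :=
  Primrec.nat_rec (f := fun _ : List α => [[]])
    (g := fun E (x : ℕ × List (List α)) => x.2.flatMap fun s => E.map fun e => e :: s)
    (Primrec.const _)
    (Primrec.list_flatMap (Primrec.snd.comp Primrec.snd)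
      (Primrec.list_map (Primrec.fst.comp Primrec.fst)
        (Primrec.list_cons.comp Primrec.snd (Primrec.snd.comp Primrec.fst)).to₂).to₂).to₂

theorem primrec_selections : Primrec (selections (α := α)) :=
  Primrec.list_foldr (f := fun l : List α => l) (g := fun _ => [[]])
    (h := fun _ (x : α × List (List α)) => x.2 ++ x.2.map fun s => x.1 :: s)
    Primrec.id (Primrec.const _)
    (Primrec.list_append.comp (Primrec.snd.comp Primrec.snd)
      (Primrec.list_map (Primrec.snd.comp Primrec.snd)
        (Primrec.list_cons.comp (Primrec.fst.comp (Primrec.snd.comp Primrec.fst))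
          Primrec.snd).to₂)).to₂

theorem primrec_boundedTerms : Primrec boundedTerms :=
  Primrec.list_append.comp
    (Primrec.list_map Primrec.list_range (primrec_term_const.comp Primrec.snd).to₂)
    (Primrec.list_flatMap Primrec.list_range
      (Primrec.list_map
        (Primrec.list_range.comp (Primrec.nat_mul.comp (Primrec.const 2) Primrec.fst))
        (primrec_term_null.comp
          (Primrec₂.natPair.comp (Primrec.snd.comp Primrec.fst) Primrec.snd)).to₂).to₂)

theorem primrec_list_sum : Primrec (List.sum : List ℕ → ℕ) :=
  Primrec.list_foldr (f := fun l : List ℕ => l) (g := fun _ => 0)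
    (h := fun _ (x : ℕ × ℕ) => x.1 + x.2) Primrec.id (Primrec.const _)
    (Primrec.nat_add.comp (Primrec.fst.comp Primrec.snd) (Primrec.snd.comp Primrec.snd)).to₂

theorem primrec_tgd_vars : Primrec TGD.vars :=
  Primrec.list_append.comp
    (Primrec.list_flatMap primrec_tgd_body (primrec_atom_args.comp Primrec.snd).to₂)
    (Primrec.list_append.comp
      (Primrec.list_flatMap primrec_tgd_head (primrec_atom_args.comp Primrec.snd).to₂)
      primrec_tgd_frontier)

theorem primrec_sizeBound : Primrec₂ sizeBound :=
  (Primrec.succ.comp <| primrec_list_sum.comp <| Primrec.list_append.comp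
    (Primrec.list_flatMap Primrec.fst (primrec_tgd_vars.comp Primrec.snd).to₂)
    (Primrec.list_map Primrec.snd (primrec_relSym_arity.comp Primrec.snd).to₂)).to₂

theorem primrec_boundedFacts : Primrec₂ boundedFacts :=
  (Primrec.list_flatMap
    (Primrec.list_append.comp
      (Primrec.list_flatMap Primrec.fst
        (Primrec.list_map (primrec_tgd_head.comp Primrec.snd)
          (primrec_atom_rel.comp Primrec.snd).to₂).to₂)
      Primrec.snd)
    (Primrec.list_map
      (primrec_tuples.comp
        (primrec_boundedTerms.comp (primrec_sizeBound.comp (Primrec.fst.comp Primrec.fst)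
          (Primrec.snd.comp Primrec.fst)))
        (primrec_relSym_arity.comp Primrec.snd))
      (primrec_fct_mk.comp (Primrec.snd.comp Primrec.fst) Primrec.snd).to₂).to₂).to₂

theorem primrec_assignment : Primrec₂ assignment :=
  Primrec.list_getD _

theorem primrec_inst_assignment : Primrec₂ fun (s : List Term) (a : Atom) => a.inst (assignment s) :=
  (primrec_fct_mk.comp (primrec_atom_rel.comp Primrec.snd)
    (Primrec.list_map (primrec_atom_args.comp Primrec.snd)
      (primrec_assignment.comp (Primrec.fst.comp Primrec.fst) Primrec.snd).to₂)).to₂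

theorem primrec_map_label : Primrec (Fct.map Term.label) :=
  primrec_fct_mk.comp primrec_fct_rel
    (Primrec.list_map primrec_fct_args (primrec_term_label.comp Primrec.snd).to₂)

theorem PrimrecPred.inst_mem {l : α → List Atom} {s : α → List Term} {J : α → List Fct}
    (hl : Primrec l) (hs : Primrec s) (hJ : Primrec J) :
    PrimrecPred fun x => ∀ a ∈ l x, a.inst (assignment (s x)) ∈ J x :=
  .forall_mem hl (.mem_list (primrec_inst_assignment.comp (hs.comp Primrec.fst) Primrec.snd)
    (hJ.comp Primrec.fst))

theorem PrimrecPred.satisfiesWithin {E : α → List Term} {N : α → ℕ} {J : α → List Fct}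
    {t : α → TGD} (hE : Primrec E) (hN : Primrec N) (hJ : Primrec J) (ht : Primrec t) :
    PrimrecPred fun x => (t x).SatisfiesWithin (E x) (N x) (J x) := by
  have htup := primrec_tuples.comp hE hN
  refine .forall_mem htup (.imp ?_ (.exists_mem (htup.comp Primrec.fst) (.and ?_ ?_)))
  · exact .inst_mem (primrec_tgd_body.comp (ht.comp Primrec.fst)) Primrec.snd (hJ.comp Primrec.fst)
  · exact .inst_mem (primrec_tgd_head.comp (ht.comp (Primrec.fst.comp Primrec.fst))) Primrec.snd
      (hJ.comp (Primrec.fst.comp Primrec.fst))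
  · exact .forall_mem (primrec_tgd_frontier.comp (ht.comp (Primrec.fst.comp Primrec.fst)))
      (Primrec.eq.comp (primrec_assignment.comp (Primrec.snd.comp Primrec.fst) Primrec.snd)
        (primrec_assignment.comp (Primrec.snd.comp (Primrec.fst.comp Primrec.fst)) Primrec.snd))

theorem PrimrecPred.hasBoundedModel {T : α → List TGD} {SD SQ : α → List RelSym}
    {D : α → List Fct} (hT : Primrec T) (hSD : Primrec SD) (hSQ : Primrec SQ) (hD : Primrec D) :
    PrimrecPred fun x => HasBoundedModel (T x) (SD x) (SQ x) (D x) := by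
  refine .exists_mem (primrec_selections.comp (primrec_boundedFacts.comp hT hSD))
    (.and ?_ (.and ?_ ?_))
  · exact .forall_mem (hD.comp Primrec.fst) (.mem_list Primrec.snd (Primrec.snd.comp Primrec.fst))
  · have hN := (primrec_sizeBound.comp hT hSD).comp
      (Primrec.fst.comp (Primrec.fst : Primrec (Prod.fst : (α × List Fct) × TGD → _)))
    exact .forall_mem (hT.comp Primrec.fst) (.satisfiesWithin (primrec_boundedTerms.comp hN) hN
      (Primrec.snd.comp Primrec.fst) Primrec.snd)
  · exact .forall_mem Primrec.snd (.imp
      (.mem_list (primrec_fct_rel.comp Primrec.snd) (hSQ.comp (Primrec.fst.comp Primrec.fst)))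
      (.mem_list (primrec_map_label.comp Primrec.snd) (hD.comp (Primrec.fst.comp Primrec.fst))))

theorem primrecPred_atom_wf : PrimrecPred Atom.wf :=
  .and (Primrec.eq.comp (Primrec.list_length.comp primrec_atom_args)
      (primrec_relSym_arity.comp primrec_atom_rel))
    (Primrec.nat_le.comp (Primrec.const 1) (primrec_relSym_arity.comp primrec_atom_rel))

theorem primrecPred_tgd_wf : PrimrecPred TGD.wf := by
  have hmem : ∀ {f : TGD → List Atom}, Primrec f →
      PrimrecPred fun x : TGD × ℕ => ∃ a ∈ f x.1, x.2 ∈ a.args := fun hf =>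
    .exists_mem (hf.comp Primrec.fst)
      (.mem_list (Primrec.snd.comp Primrec.fst) (primrec_atom_args.comp Primrec.snd))
  have hvars : PrimrecPred fun t : TGD => ∀ x ∈ t.vars, (∃ a ∈ t.body, x ∈ a.args) →
      (∃ a ∈ t.head, x ∈ a.args) → x ∈ t.frontier :=
    .forall_mem primrec_tgd_vars (.imp (hmem primrec_tgd_body) (.imp (hmem primrec_tgd_head)
      (.mem_list Primrec.snd (primrec_tgd_frontier.comp Primrec.fst))))
  refine .and (.forall_mem primrec_tgd_body (primrecPred_atom_wf.comp Primrec.snd)) <|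
    .and (.forall_mem primrec_tgd_head (primrecPred_atom_wf.comp Primrec.snd)) <|
    .and (.nodup primrec_tgd_frontier) <|
    .and (.forall_mem primrec_tgd_frontier (hmem primrec_tgd_body)) (hvars.of_eq fun t => ?_)
  refine ⟨fun h x hb hh => h x ?_ hb hh, fun h x _ => h x⟩
  exact List.mem_append_left _ (List.mem_flatMap.2 hb)

theorem primrecPred_tgd_linear : PrimrecPred TGD.Linear :=
  Primrec.nat_le.comp (Primrec.list_length.comp primrec_tgd_body) (Primrec.const 1)

end Primrec

/-- triviality for linear TGDs is decidable. -/
theorem triviality_linear_decidable :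
    ComputablePred (fun x : List TGD × List RelSym × List RelSym =>
        (∀ t ∈ x.1, t.wf ∧ t.Linear) ∧
        HomTrivial x.1 { r | r ∈ x.2.1 } { r | r ∈ x.2.2 }) := by
  have hwf : PrimrecPred fun x : List TGD × List RelSym × List RelSym =>
      ∀ t ∈ x.1, t.wf ∧ t.Linear :=
    .forall_mem Primrec.fst
      (.and (primrecPred_tgd_wf.comp Primrec.snd) (primrecPred_tgd_linear.comp Primrec.snd))
  have hSD : Primrec fun x : List TGD × List RelSym × List RelSym => x.2.1 :=
    Primrec.fst.comp Primrec.snd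
  have hSQ : Primrec fun x : List TGD × List RelSym × List RelSym => x.2.2 :=
    Primrec.snd.comp Primrec.snd
  have h0 : PrimrecPred fun x : List TGD × List RelSym × List RelSym =>
      HasBoundedModel x.1 x.2.1 x.2.2 [] :=
    .hasBoundedModel Primrec.fst hSD hSQ (Primrec.const [])
  have h1 : PrimrecPred fun x : List TGD × List RelSym × List RelSym =>
      ∀ R ∈ x.2.1, 1 ≤ R.arity → ∀ s ∈ tuples (List.range (sizeBound x.1 x.2.1)) R.arity,
        HasBoundedModel x.1 x.2.1 x.2.2 [⟨R, s.map Term.const⟩] := by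
    refine .forall_mem hSD (.imp ?_ (.forall_mem ?_ (.hasBoundedModel ?_ ?_ ?_ ?_)))
    · exact Primrec.nat_le.comp (Primrec.const 1) (primrec_relSym_arity.comp Primrec.snd)
    · exact primrec_tuples.comp
        (Primrec.list_range.comp
          ((primrec_sizeBound.comp Primrec.fst hSD).comp Primrec.fst))
        (primrec_relSym_arity.comp Primrec.snd)
    · exact Primrec.fst.comp (Primrec.fst.comp Primrec.fst)
    · exact hSD.comp (Primrec.fst.comp Primrec.fst)
    · exact hSQ.comp (Primrec.fst.comp Primrec.fst)
    · exact Primrec.list_cons.comp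
        (primrec_fct_mk.comp (Primrec.snd.comp Primrec.fst)
          (Primrec.list_map Primrec.snd (primrec_term_const.comp Primrec.snd).to₂))
        (Primrec.const [])
  refine ((hwf.and (h0.and h1)).of_eq fun x => ?_).computablePred
  exact and_congr_right fun hx => (homTrivial_iff hx x.2.1 x.2.2).symm
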